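/- Let K be a field of characteristic p > 0, A = K[[Y]], Q(A) its field of fractions, and let M be a ℤⁿ-graded F-finite F-module over R = A[X₁,…,Xₙ]. Let U ⊆ {1,…,n} and let u, v ∈ B(U). If M_u ≅ (Q(A)/A)^{a} ⊕ Q(A)^{b} ⊕ A^{c} and M_v ≅ (Q(A)/A)^{a'} ⊕ Q(A)^{b'} ⊕ A^{c'} as A-modules, with a, b, c, a', b', c' natural numbers, then a = a', b = b', and c = c'; that is, the numbers a(u), b(u), c(u) occurring in the structure theorem are constant on each block B(U). -/

import Mathlib

set_option maxHeartbeats 1000000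
set_option synthInstance.maxHeartbeats 1000000

open scoped TensorProduct

noncomputable section

/-- `R = A[X₁, …, Xₙ]`, the polynomial ring in `n` variables over `A`,
`ℕⁿ`-graded with `A` in degree `0` and `deg Xⱼ = eⱼ`. -/
abbrev PolyR (n : ℕ) (A : Type) [CommRing A] : Type := MvPolynomial (Fin n) A

/-- A polynomial is (multi)homogeneous of degree `d ∈ ℤⁿ` if every monomial occurring in it
has exponent vector `d` (under the grading `deg Xⱼ = eⱼ`). -/
def IsHomog {n : ℕ} {A : Type} [CommRing A] (r : PolyR n A) (d : Fin n → ℤ) : Prop :=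
  ∀ m ∈ r.support, (fun i => ((m i : ℕ) : ℤ)) = d

/-- Type synonym: `R` viewed as an `R`-algebra via the Frobenius `r ↦ r ^ p`. -/
@[nolint unusedArguments]
def FrobTwist (_p n : ℕ) (A : Type) [CommRing A] : Type := PolyR n A

instance (p n : ℕ) (A : Type) [CommRing A] : CommRing (FrobTwist p n A) :=
  inferInstanceAs (CommRing (PolyR n A))

/-- The Frobenius `r ↦ r ^ p`, as a ring homomorphism `R →+* FrobTwist p n A`. -/
def frobToTwist (p n : ℕ) (A : Type) [CommRing A] [Fact p.Prime] [CharP A p] :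
    PolyR n A →+* FrobTwist p n A := frobenius (PolyR n A) p

/-- The `R`-algebra structure on `FrobTwist p n A` given by the Frobenius. -/
instance (p n : ℕ) (A : Type) [CommRing A] [Fact p.Prime] [CharP A p] :
    Algebra (PolyR n A) (FrobTwist p n A) := (frobToTwist p n A).toAlgebra

/-- `F(M) = R ⊗_R M`, the base change of `M` along the Frobenius endomorphism of `R`,
an `R`-module via the left factor. -/
def FF (p n : ℕ) (A : Type) [CommRing A] [Fact p.Prime] [CharP A p]
    (M : Type) [AddCommGroup M] [Module (PolyR n A) M] : Type :=
  FrobTwist p n A ⊗[PolyR n A] M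

section FFInst

variable (p n : ℕ) (A : Type) [CommRing A] [Fact p.Prime] [CharP A p]
variable (M N : Type) [AddCommGroup M] [Module (PolyR n A) M]
  [AddCommGroup N] [Module (PolyR n A) N]

instance : AddCommGroup (FF p n A M) :=
  inferInstanceAs (AddCommGroup (FrobTwist p n A ⊗[PolyR n A] M))

instance : Module (PolyR n A) (FF p n A M) :=
  inferInstanceAs (Module (FrobTwist p n A) (FrobTwist p n A ⊗[PolyR n A] M))

instance : Module A (FF p n A M) :=
  Module.compHom (FF p n A M) (algebraMap A (PolyR n A))

instance : IsScalarTower A (PolyR n A) (FF p n A M) where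
  smul_assoc a r x := by
    show ((a • r) • x : FF p n A M) = (algebraMap A (PolyR n A) a) • (r • x)
    rw [Algebra.smul_def, mul_smul]

/-- Inclusion of elements of the tensor product into `F(M)`. -/
def FF.of (x : FrobTwist p n A ⊗[PolyR n A] M) : FF p n A M := x

/-- An element of `R`, viewed in `FrobTwist p n A`. -/
def twist (r : PolyR n A) : FrobTwist p n A := r

/-- The degree-`u` component of `F(M)` induced by a grading `gr` on `M`:
the `A`-span of the homogeneous tensors `r ⊗ m` with `deg(r ⊗ m) = deg r + p • deg m = u`. -/
def FF.comp [Module A M] (gr : (Fin n → ℤ) → Submodule A M) (u : Fin n → ℤ) :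
    Submodule A (FF p n A M) :=
  Submodule.span A { x : FF p n A M |
    ∃ (r : PolyR n A) (d v : Fin n → ℤ) (m : M),
      IsHomog r d ∧ m ∈ gr v ∧ d + p • v = u ∧
      x = FF.of p n A M (twist p n A r ⊗ₜ[PolyR n A] m) }

/-- Functoriality of `F`. -/
def FF.map {M N} [AddCommGroup M] [Module (PolyR n A) M]
    [AddCommGroup N] [Module (PolyR n A) N] (f : M →ₗ[PolyR n A] N) :
    FF p n A M →ₗ[PolyR n A] FF p n A N :=
  LinearMap.baseChange (FrobTwist p n A) f

end FFInst

/-- A bundled `ℤⁿ`-graded module over `R = A[X₁,…,Xₙ]`: a module together with a family of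
`A`-submodules indexed by `ℤⁿ` (the candidate graded components). -/
structure GrMod (p n : ℕ) (A : Type) [CommRing A] [Fact p.Prime] [CharP A p] : Type 1 where
  carrier : Type
  [acg : AddCommGroup carrier]
  [modA : Module A carrier]
  [modR : Module (PolyR n A) carrier]
  [tower : IsScalarTower A (PolyR n A) carrier]
  gr : (Fin n → ℤ) → Submodule A carrier

attribute [instance] GrMod.acg GrMod.modA GrMod.modR GrMod.tower

variable {p n : ℕ} {A : Type} [CommRing A] [Fact p.Prime] [CharP A p]

/-- The Frobenius functor applied to a bundled graded module, with the induced grading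
`deg(r ⊗ m) = deg r + p • deg m`. -/
def GrMod.F (X : GrMod p n A) : GrMod p n A where
  carrier := FF p n A X.carrier
  gr := FF.comp p n A X.carrier X.gr

/-- Iterates `F^k(X)` of the Frobenius functor on a bundled graded module. -/
def GrMod.FPow (X : GrMod p n A) : ℕ → GrMod p n A
  | 0 => X
  | (k + 1) => (X.FPow k).F

/-- The maps `F^k(β) : F^k(U) → F^(k+1)(U)` of the direct system induced by a generating
morphism `β : U → F(U)`. -/
def GrMod.seqMap (X : GrMod p n A) (β : X.carrier →ₗ[PolyR n A] X.F.carrier) :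
    ∀ k : ℕ, (X.FPow k).carrier →ₗ[PolyR n A] (X.FPow (k + 1)).carrier
  | 0 => β
  | (k + 1) => FF.map p n A (X.seqMap β k)

/-- The composite transition maps `F^k(U) → F^(k+l)(U)` of the direct system. -/
def GrMod.trans (X : GrMod p n A) (β : X.carrier →ₗ[PolyR n A] X.F.carrier) :
    ∀ (k l : ℕ), (X.FPow k).carrier →ₗ[PolyR n A] (X.FPow (k + l)).carrier
  | _, 0 => LinearMap.id
  | k, (l + 1) => (X.seqMap β (k + l)).comp (X.trans β k l)

/-- `M`, together with the family `gr` of its `A`-submodule components, is a `ℤⁿ`-graded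
`F`-finite `F`-module over `R = A[X₁,…,Xₙ]`.  The fields say:
* `gr` is a `ℤⁿ`-grading of `M` by `A`-submodules making `M` a graded `R`-module
  (`isInternal`, `smul_X_mem`);
* `theta : M ≅ F(M)` is a degree-preserving `R`-linear isomorphism (`theta`, `theta_grade`),
  where the grading on `F(M)` is given by `deg (r ⊗ m) = deg r + p • deg m`;
* `M` is the direct limit of `U →β F(U) →F(β) F²(U) → ⋯` for a degree-preserving generating
  morphism `β : U → F(U)` from a finitely generated `ℤⁿ`-graded module `U` (= `gen.carrier`),
  via degree-preserving structure maps `toLim k : F^k(U) → M` (`toLim_compat`, `toLim_grade`,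
  `toLim_surj`, `toLim_ker` say precisely that `M` is the colimit of the system), compatibly
  with `theta` (`theta_compat`). -/
structure ZGradedFFiniteFModule (p n : ℕ) (A : Type) [CommRing A] [Fact p.Prime] [CharP A p]
    (M : Type) [AddCommGroup M] [Module A M] [Module (PolyR n A) M]
    [IsScalarTower A (PolyR n A) M]
    (gr : (Fin n → ℤ) → Submodule A M) : Type 1 where
  isInternal : DirectSum.IsInternal gr
  smul_X_mem : ∀ (i : Fin n) (u : Fin n → ℤ), ∀ m ∈ gr u,
    (MvPolynomial.X i : PolyR n A) • m ∈ gr (u + Pi.single i 1)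
  theta : M ≃ₗ[PolyR n A] FF p n A M
  theta_grade : ∀ (u : Fin n → ℤ), ∀ m ∈ gr u, theta m ∈ FF.comp p n A M gr u
  gen : GrMod p n A
  gen_fg : Module.Finite (PolyR n A) gen.carrier
  gen_internal : DirectSum.IsInternal gen.gr
  gen_smul_X_mem : ∀ (i : Fin n) (u : Fin n → ℤ), ∀ x ∈ gen.gr u,
    (MvPolynomial.X i : PolyR n A) • x ∈ gen.gr (u + Pi.single i 1)
  beta : gen.carrier →ₗ[PolyR n A] gen.F.carrier
  beta_grade : ∀ (u : Fin n → ℤ), ∀ x ∈ gen.gr u, beta x ∈ gen.F.gr u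
  toLim : ∀ k : ℕ, (gen.FPow k).carrier →ₗ[PolyR n A] M
  toLim_compat : ∀ (k : ℕ) (x : (gen.FPow k).carrier),
    toLim (k + 1) (gen.seqMap beta k x) = toLim k x
  toLim_grade : ∀ (k : ℕ) (u : Fin n → ℤ), ∀ x ∈ (gen.FPow k).gr u, toLim k x ∈ gr u
  toLim_surj : ∀ m : M, ∃ (k : ℕ) (x : (gen.FPow k).carrier), toLim k x = m
  toLim_ker : ∀ (k : ℕ) (x : (gen.FPow k).carrier), toLim k x = 0 →
    ∃ l : ℕ, gen.trans beta k l x = 0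
  theta_compat : ∀ (k : ℕ) (x : (gen.FPow k).carrier),
    theta (toLim k x) = FF.map p n A (toLim k) (gen.seqMap beta k x)

/-- The block `B(U) ⊆ ℤⁿ` associated to a subset `U ⊆ {1,…,n}`:
`uᵢ ≥ 0` for `i ∈ U` and `uᵢ ≤ -1` for `i ∉ U`. -/
def Block (n : ℕ) (U : Set (Fin n)) : Set (Fin n → ℤ) :=
  { u | ∀ i : Fin n, (i ∈ U → 0 ≤ u i) ∧ (i ∉ U → u i ≤ -1) }

/-- A ring of characteristic `p` injects its characteristic into power series. -/
instance (K : Type) [Field K] (p : ℕ) [CharP K p] : CharP (PowerSeries K) p :=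
  charP_of_injective_ringHom (PowerSeries.C_injective (R := K)) p

/-- `Q(A)`, the field of fractions of `A = K[[Y]]`. -/
abbrev QA (K : Type) [Field K] : Type := FractionRing (PowerSeries K)

/-- `Q(A)/A`, which is isomorphic to the injective hull `E(A/YA)` of the residue field of
`A = K[[Y]]`. -/
abbrev QmodA (K : Type) [Field K] : Type :=
  (QA K) ⧸ LinearMap.range (Algebra.linearMap (PowerSeries K) (QA K))

section Uniqueness

variable (K : Type) [Field K]

/-- The residue field `A/YA` of `A = K[[Y]]`, as an `A`-module. -/
abbrev ResY : Type := PowerSeries K ⧸ Ideal.span {(PowerSeries.X : PowerSeries K)}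

theorem length_resY : Module.length (PowerSeries K) (ResY K) = 1 := by
  rw [Module.length_eq_one_iff, isSimpleModule_iff_isCoatom, ← Ideal.isMaximal_def,
    ← PowerSeries.maximalIdeal_eq_span_X]
  infer_instance

theorem X_smul_resY (x : ResY K) : (PowerSeries.X : PowerSeries K) • x = 0 := by
  obtain ⟨x, rfl⟩ := Submodule.Quotient.mk_surjective _ x
  rw [← Submodule.Quotient.mk_smul, Submodule.Quotient.mk_eq_zero, smul_eq_mul]
  exact Ideal.mul_mem_right _ _ (Ideal.subset_span rfl)

theorem exists_X_smul_QA (q : QA K) : ∃ q', q = (PowerSeries.X : PowerSeries K) • q' := by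
  refine ⟨(algebraMap (PowerSeries K) (QA K) PowerSeries.X)⁻¹ * q, ?_⟩
  rw [Algebra.smul_def, mul_inv_cancel_left₀]
  simp

theorem exists_X_smul_QmodA (q : QmodA K) : ∃ q', q = (PowerSeries.X : PowerSeries K) • q' := by
  obtain ⟨x, rfl⟩ := Submodule.Quotient.mk_surjective _ q
  obtain ⟨y, rfl⟩ := exists_X_smul_QA K x
  exact ⟨Submodule.Quotient.mk y, Submodule.Quotient.mk_smul _ _ _⟩

theorem subsingleton_resY_tensor (N : Type) [AddCommGroup N] [Module (PowerSeries K) N]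
    (h : ∀ q : N, ∃ q', q = (PowerSeries.X : PowerSeries K) • q') :
    Subsingleton (ResY K ⊗[PowerSeries K] N) := by
  refine subsingleton_of_forall_eq 0 fun t => ?_
  induction t with
  | zero => rfl
  | add x y hx hy => rw [hx, hy, add_zero]
  | tmul x y =>
    obtain ⟨y, rfl⟩ := h y
    rw [← TensorProduct.smul_tmul, X_smul_resY, TensorProduct.zero_tmul]

theorem subsingleton_resY_hom (N : Type) [AddCommGroup N] [Module (PowerSeries K) N]
    [Module.IsTorsionFree (PowerSeries K) N] :
    Subsingleton (ResY K →ₗ[PowerSeries K] N) := by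
  refine subsingleton_of_forall_eq 0 fun f => LinearMap.ext fun x => ?_
  have : (PowerSeries.X : PowerSeries K) • f x = 0 := by
    rw [← map_smul, X_smul_resY, map_zero]
  exact (smul_eq_zero.1 this).resolve_left PowerSeries.X_ne_zero

theorem exists_algebraMap_mul (q : QA K) : ∃ s : PowerSeries K, s ≠ 0 ∧
    ∃ x : PowerSeries K, s • q = algebraMap _ _ x := by
  obtain ⟨x, s, hs, rfl⟩ := IsFractionRing.div_surjective (A := PowerSeries K) q
  have hs' := nonZeroDivisors.ne_zero hs
  refine ⟨s, hs', x, ?_⟩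
  rw [Algebra.smul_def, mul_div_cancel₀]
  simpa using hs'

theorem subsingleton_QA_tensor_QmodA : Subsingleton (QA K ⊗[PowerSeries K] QmodA K) := by
  refine subsingleton_of_forall_eq 0 fun t => ?_
  induction t with
  | zero => rfl
  | add x y hx hy => rw [hx, hy, add_zero]
  | tmul x y =>
    obtain ⟨y, rfl⟩ := Submodule.Quotient.mk_surjective _ y
    obtain ⟨s, hs, z, hz⟩ := exists_algebraMap_mul K y
    have hx : x = s • ((algebraMap (PowerSeries K) (QA K) s)⁻¹ * x) := by
      rw [Algebra.smul_def, mul_inv_cancel_left₀]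
      simpa using hs
    rw [hx, TensorProduct.smul_tmul, ← Submodule.Quotient.mk_smul, hz,
      show (Submodule.Quotient.mk (algebraMap _ _ z) : QmodA K) = 0 from
        (Submodule.Quotient.mk_eq_zero _).2 (LinearMap.mem_range.2 ⟨z, rfl⟩), TensorProduct.tmul_zero]

theorem length_resY_hom_QmodA :
    Module.length (PowerSeries K) (ResY K →ₗ[PowerSeries K] QmodA K) = 1 := by
  have hX : algebraMap (PowerSeries K) (QA K) PowerSeries.X ≠ 0 := by
    simp
  let q₀ : QA K := (algebraMap (PowerSeries K) (QA K) PowerSeries.X)⁻¹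
  let f₀ : ResY K →ₗ[PowerSeries K] QmodA K :=
    Submodule.liftQ _ (LinearMap.toSpanSingleton _ _ (Submodule.Quotient.mk q₀)) (by
      rw [Ideal.span, Submodule.span_le, Set.singleton_subset_iff, SetLike.mem_coe,
        LinearMap.mem_ker, LinearMap.toSpanSingleton_apply, ← Submodule.Quotient.mk_smul,
        Submodule.Quotient.mk_eq_zero, LinearMap.mem_range]
      exact ⟨1, by simp [q₀, Algebra.smul_def, hX]⟩)
  have hf₀ : f₀ (Submodule.Quotient.mk 1) = Submodule.Quotient.mk q₀ := by
    exact (Submodule.liftQ_apply _ _ _).trans (by simp)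
  have hext : ∀ f g : ResY K →ₗ[PowerSeries K] QmodA K,
      f (Submodule.Quotient.mk 1) = g (Submodule.Quotient.mk 1) → f = g := by
    intro f g h
    refine Submodule.linearMap_qext _ (LinearMap.ext_ring ?_)
    simpa using h
  let g : PowerSeries K →ₗ[PowerSeries K] (ResY K →ₗ[PowerSeries K] QmodA K) :=
    LinearMap.toSpanSingleton _ _ f₀
  have hsurj : Function.Surjective g := by
    intro f
    obtain ⟨q, hq⟩ := Submodule.Quotient.mk_surjective _ (f (Submodule.Quotient.mk 1))
    have h : (PowerSeries.X : PowerSeries K) • f (Submodule.Quotient.mk 1) = 0 := by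
      rw [← map_smul, X_smul_resY, map_zero]
    rw [← hq, ← Submodule.Quotient.mk_smul, Submodule.Quotient.mk_eq_zero] at h
    obtain ⟨x, hx⟩ := h
    refine ⟨x, hext _ _ ?_⟩
    rw [LinearMap.toSpanSingleton_apply, LinearMap.smul_apply, hf₀, ← hq,
      ← Submodule.Quotient.mk_smul]
    congr 1
    rw [Algebra.linearMap_apply, Algebra.smul_def] at hx
    rw [Algebra.smul_def, hx, mul_comm, inv_mul_cancel_left₀ hX]
  have hker : LinearMap.ker g = Ideal.span {(PowerSeries.X : PowerSeries K)} := by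
    ext x
    rw [LinearMap.mem_ker, Ideal.mem_span_singleton']
    have : g x = 0 ↔ (Submodule.Quotient.mk (x • q₀) : QmodA K) = 0 := by
      rw [Submodule.Quotient.mk_smul, ← hf₀, ← LinearMap.smul_apply]
      exact ⟨fun h => by rw [← LinearMap.toSpanSingleton_apply, h, LinearMap.zero_apply],
        fun h => hext _ _ h⟩
    rw [this, Submodule.Quotient.mk_eq_zero]
    refine exists_congr fun y => ?_
    rw [Algebra.linearMap_apply, Algebra.smul_def, eq_mul_inv_iff_mul_eq₀ hX, ← map_mul]
    exact (IsFractionRing.injective (PowerSeries K) (QA K)).eq_iff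
  rw [← (LinearMap.quotKerEquivOfSurjective g hsurj).length_eq, hker]
  exact length_resY K

theorem length_hom_pi (R P N : Type) [CommRing R] [AddCommGroup P] [Module R P]
    [AddCommGroup N] [Module R N] (k : ℕ) :
    Module.length R (P →ₗ[R] (Fin k → N)) = k * Module.length R (P →ₗ[R] N) := by
  let e : (Fin k → (P →ₗ[R] N)) ≃ₗ[R] (P →ₗ[R] (Fin k → N)) :=
    { toFun := LinearMap.pi
      invFun := fun f i => LinearMap.proj i ∘ₗ f
      map_add' := fun _ _ => rfl
      map_smul' := fun _ _ => rfl
      left_inv := fun _ => rfl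
      right_inv := fun _ => rfl }
  rw [← e.length_eq, Module.length_pi_of_fintype]
  simp

theorem length_hom_prod (R P N N' : Type) [CommRing R] [AddCommGroup P] [Module R P]
    [AddCommGroup N] [Module R N] [AddCommGroup N'] [Module R N'] :
    Module.length R (P →ₗ[R] N × N') =
      Module.length R (P →ₗ[R] N) + Module.length R (P →ₗ[R] N') := by
  rw [← (LinearMap.prodEquiv (M := P) (M₂ := N) (M₃ := N') R).length_eq, Module.length_prod]

theorem length_tensor_prod (R P N N' : Type) [CommRing R] [AddCommGroup P] [Module R P]
    [AddCommGroup N] [Module R N] [AddCommGroup N'] [Module R N'] :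
    Module.length R (P ⊗[R] (N × N')) =
      Module.length R (P ⊗[R] N) + Module.length R (P ⊗[R] N') := by
  rw [(TensorProduct.prodRight R R P N N').length_eq, Module.length_prod]

variable (a b c : ℕ)

/-- The module `(Q(A)/A)^a ⊕ Q(A)^b ⊕ A^c`. -/
abbrev StdModule : Type := (Fin a → QmodA K) × (Fin b → QA K) × (Fin c → PowerSeries K)

theorem length_resY_hom_stdModule :
    Module.length (PowerSeries K) (ResY K →ₗ[PowerSeries K] StdModule K a b c) = a := by
  have h₁ := subsingleton_resY_hom K (Fin b → QA K)
  have h₂ := subsingleton_resY_hom K (Fin c → PowerSeries K)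
  rw [length_hom_prod, length_hom_prod, length_hom_pi, length_resY_hom_QmodA]
  simp

theorem length_resY_tensor_stdModule :
    Module.length (PowerSeries K) (ResY K ⊗[PowerSeries K] StdModule K a b c) = c := by
  have h₁ := subsingleton_resY_tensor K (Fin a → QmodA K) fun q => by
    choose f hf using fun i => exists_X_smul_QmodA K (q i)
    exact ⟨f, funext hf⟩
  have h₂ := subsingleton_resY_tensor K (Fin b → QA K) fun q => by
    choose f hf using fun i => exists_X_smul_QA K (q i)
    exact ⟨f, funext hf⟩
  rw [length_tensor_prod, length_tensor_prod,
    (TensorProduct.piScalarRight (PowerSeries K) (PowerSeries K) (ResY K) (Fin c)).length_eq,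
    Module.length_pi_of_fintype]
  simp [length_resY]

theorem finrank_QA_tensor_stdModule :
    Module.finrank (QA K) (QA K ⊗[PowerSeries K] StdModule K a b c) = b + c := by
  have h₀ := subsingleton_QA_tensor_QmodA K
  have h₁ : Subsingleton (QA K ⊗[PowerSeries K] (Fin a → QmodA K)) :=
    (TensorProduct.piRight (PowerSeries K) (QA K) (QA K)
      (fun _ : Fin a => QmodA K)).toEquiv.subsingleton
  have e : (QA K ⊗[PowerSeries K] StdModule K a b c) ≃ₗ[QA K]
      (QA K ⊗[PowerSeries K] (Fin a → QmodA K)) × (Fin b → QA K) × (Fin c → QA K) :=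
    TensorProduct.prodRight (PowerSeries K) (QA K) _ _ _ ≪≫ₗ
    LinearEquiv.prodCongr (LinearEquiv.refl _ _)
      (TensorProduct.prodRight (PowerSeries K) (QA K) _ _ _ ≪≫ₗ
      LinearEquiv.prodCongr
        (TensorProduct.piRight (PowerSeries K) (QA K) (QA K) (fun _ : Fin b => QA K) ≪≫ₗ
          LinearEquiv.piCongrRight fun _ =>
            ((IsLocalization.moduleTensorEquiv (nonZeroDivisors (PowerSeries K)) (QA K) (QA K)
              (QA K)).symm ≪≫ₗ
            TensorProduct.lid (QA K) (QA K)))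
        (TensorProduct.piScalarRight (PowerSeries K) (QA K) _ _))
  rw [e.finrank_eq, Module.finrank_prod, Module.finrank_prod, Module.finrank_zero_of_subsingleton]
  simp

theorem stdModule_unique {a b c a' b' c' : ℕ}
    (e : StdModule K a b c ≃ₗ[PowerSeries K] StdModule K a' b' c') :
    a = a' ∧ b = b' ∧ c = c' := by
  have ha := (e.congrRight (M := ResY K)).length_eq
  rw [length_resY_hom_stdModule, length_resY_hom_stdModule, Nat.cast_inj] at ha
  have hc := (LinearEquiv.lTensor (ResY K) e).length_eq
  rw [length_resY_tensor_stdModule, length_resY_tensor_stdModule, Nat.cast_inj] at hc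
  have hb := (e.baseChange (PowerSeries K) (QA K) _ _).finrank_eq
  rw [finrank_QA_tensor_stdModule, finrank_QA_tensor_stdModule] at hb
  omega

end Uniqueness

section FrobeniusComponents

/-- Type synonym: `A` viewed as an `A`-algebra via the Frobenius `a ↦ a ^ p`. -/
def FrobBase (_p : ℕ) (A : Type) : Type := A

instance (p : ℕ) (A : Type) [CommRing A] : CommRing (FrobBase p A) :=
  inferInstanceAs (CommRing A)

/-- The identity `A ≃+* FrobBase p A`, which is not `A`-linear. -/
def toFrobBase (p : ℕ) (A : Type) [CommRing A] : A ≃+* FrobBase p A := RingEquiv.refl A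

instance (p : ℕ) (A : Type) [CommRing A] [Fact p.Prime] [CharP A p] :
    Algebra A (FrobBase p A) :=
  ((toFrobBase p A).toRingHom.comp (frobenius A p)).toAlgebra

variable {p n : ℕ} {A : Type} [CommRing A] [Fact p.Prime] [CharP A p]

theorem smul_toFrobBase (a b : A) :
    a • toFrobBase p A b = toFrobBase p A (a ^ p * b) := rfl

theorem smul_twist (r s : PolyR n A) :
    (r • twist p n A s : FrobTwist p n A) = twist p n A (r ^ p * s) := rfl

/-- The componentwise floor of `u / p`. -/
def floorDiv (p : ℕ) (u : Fin n → ℤ) : Fin n → ℤ := fun i => u i / p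

/-- The componentwise residue of `u` modulo `p`, as an exponent vector. -/
def residue (p : ℕ) (u : Fin n → ℤ) : Fin n →₀ ℕ :=
  Finsupp.equivFunOnFinite.symm fun i => (u i % p).toNat

/-- The componentwise quotient of an exponent vector by `p`. -/
def expDiv (p : ℕ) (d : Fin n →₀ ℕ) : Fin n →₀ ℕ := d.mapRange (· / p) (Nat.zero_div p)

variable {M : Type} [AddCommGroup M] [Module A M] [Module (PolyR n A) M]
  [IsScalarTower A (PolyR n A) M] {gr : (Fin n → ℤ) → Submodule A M}

theorem monomial_smul_eq (d : Fin n →₀ ℕ) (a : A) (m : M) :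
    (MvPolynomial.monomial d a : PolyR n A) • m =
      a • (MvPolynomial.monomial d 1 : PolyR n A) • m := by
  rw [← smul_assoc, MvPolynomial.smul_monomial, smul_eq_mul, mul_one]

omit [IsScalarTower A (PolyR n A) M] in
theorem monomial_smul_mem
    (hX : ∀ (i : Fin n) (u : Fin n → ℤ), ∀ m ∈ gr u,
      (MvPolynomial.X i : PolyR n A) • m ∈ gr (u + Pi.single i 1))
    (d : Fin n →₀ ℕ) : ∀ {v : Fin n → ℤ} {m : M}, m ∈ gr v →
      (MvPolynomial.monomial d 1 : PolyR n A) • m ∈ gr (v + fun i => ((d i : ℕ) : ℤ)) := by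
  induction d using Finsupp.induction_linear with
  | zero =>
    intro v m hm
    simpa [show (v + fun i : Fin n => (0 : ℤ)) = v from add_zero v] using hm
  | add d e hd he =>
    intro v m hm
    have := hd (he hm)
    rw [← mul_smul, MvPolynomial.monomial_mul, one_mul] at this
    convert this using 2
    ext i
    simp [add_comm, add_left_comm]
  | single i k =>
    intro v m hm
    induction k with
    | zero => simpa [show (v + fun i : Fin n => (0 : ℤ)) = v from add_zero v] using hm
    | succ k ih =>
      have := hX i _ _ ih
      rw [← mul_smul, MvPolynomial.X, MvPolynomial.monomial_mul, one_mul, ← Finsupp.single_add] at this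
      have hk : (v + fun j => ((Finsupp.single i k j : ℕ) : ℤ)) + Pi.single i 1 =
          v + fun j => ((Finsupp.single i (k + 1) j : ℕ) : ℤ) := by
        ext j
        rcases eq_or_ne i j with rfl | h
        · simp [add_assoc]
        · simp [Finsupp.single_apply, h]
      rwa [hk, add_comm 1 k] at this

/-- The projection of an internally graded module onto its degree-`w` component. -/
def proj (h : DirectSum.IsInternal gr) (w : Fin n → ℤ) : M →ₗ[A] gr w :=
  DirectSum.component A _ (fun i => gr i) w ∘ₗ
    (LinearEquiv.ofBijective (DirectSum.coeLinearMap gr) h).symm.toLinearMap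

omit [Module (PolyR n A) M] [IsScalarTower A (PolyR n A) M] in
theorem proj_of_mem (h : DirectSum.IsInternal gr) (w w' : Fin n → ℤ) (m : gr w') :
    proj h w m = DirectSum.component A _ _ w (DirectSum.lof A _ (fun i => gr i) w' m) := by
  refine congrArg (DirectSum.component A _ (fun i => gr i) w) ?_
  change (LinearEquiv.ofBijective (DirectSum.coeLinearMap gr) h).symm m = _
  rw [LinearEquiv.symm_apply_eq]
  exact (DirectSum.coeLinearMap_lof gr w' m).symm

omit [Module (PolyR n A) M] [IsScalarTower A (PolyR n A) M] in
theorem proj_self (h : DirectSum.IsInternal gr) (w : Fin n → ℤ) (m : gr w) :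
    proj h w m = m := by
  rw [proj_of_mem, DirectSum.component.lof_self]

omit [Module (PolyR n A) M] [IsScalarTower A (PolyR n A) M] in
theorem proj_of_ne (h : DirectSum.IsInternal gr) {w w' : Fin n → ℤ} (hw : w' ≠ w)
    (m : gr w') : proj h w m = 0 := by
  rw [proj_of_mem, DirectSum.component.of, dif_neg hw]

/-- `a X^d ⊗ m ↦ a ⊗ (X^⌊d/p⌋ m)_⌊u/p⌋`, for a fixed exponent `d`. -/
def coordAux (h : DirectSum.IsInternal gr) (u : Fin n → ℤ) (d : Fin n →₀ ℕ) :
    A →+ M →+ FrobBase p A ⊗[A] gr (floorDiv p u) :=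
  AddMonoidHom.mk' (fun a => AddMonoidHom.mk' (fun m => toFrobBase p A a ⊗ₜ[A]
      proj h (floorDiv p u) ((MvPolynomial.monomial (expDiv p d) 1 : PolyR n A) • m))
      (fun x y => by rw [smul_add, map_add, TensorProduct.tmul_add]))
    (fun a b => by
      ext m
      simp [TensorProduct.add_tmul])

open Classical in
/-- The additive extension of `coordAux` to polynomials, over the exponents congruent to `u` mod `p`. -/
def coordBilin (h : DirectSum.IsInternal gr) (u : Fin n → ℤ) :
    FrobTwist p n A →+ M →+ FrobBase p A ⊗[A] gr (floorDiv p u) :=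
  (Finsupp.liftAddHom (fun d : Fin n →₀ ℕ =>
    if ∀ i, (d i : ℤ) % p = u i % p then coordAux h u d else 0)).comp
    (MvPolynomial.basisMonomials (Fin n) A).repr.toLinearMap.toAddMonoidHom

omit [IsScalarTower A (PolyR n A) M] in
open Classical in
theorem coordBilin_monomial (h : DirectSum.IsInternal gr) (u : Fin n → ℤ) (d : Fin n →₀ ℕ)
    (a : A) (m : M) :
    coordBilin h u (twist p n A (MvPolynomial.monomial d a)) m =
      if ∀ i, (d i : ℤ) % p = u i % p then toFrobBase p A a ⊗ₜ[A]
        proj h (floorDiv p u) ((MvPolynomial.monomial (expDiv p d) 1 : PolyR n A) • m) else 0 := by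
  have : (MvPolynomial.basisMonomials (Fin n) A).repr (MvPolynomial.monomial d a) =
      Finsupp.single d a := by
    have := (MvPolynomial.basisMonomials (Fin n) A).repr_self d
    rw [MvPolynomial.coe_basisMonomials] at this
    rw [← mul_one a, ← smul_eq_mul, ← MvPolynomial.smul_monomial, map_smul, this,
      Finsupp.smul_single]
  have hrepr : coordBilin h u (twist p n A (MvPolynomial.monomial d a)) =
    Finsupp.liftAddHom (fun d : Fin n →₀ ℕ =>
      if ∀ i, (d i : ℤ) % p = u i % p then coordAux (p := p) h u d else 0)
      ((MvPolynomial.basisMonomials (Fin n) A).repr (MvPolynomial.monomial d a)) := rfl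
  rw [hrepr, this, Finsupp.liftAddHom_apply_single]
  split_ifs <;> rfl

theorem expDiv_smul_add (c d : Fin n →₀ ℕ) : expDiv p (p • c + d) = c + expDiv p d := by
  ext i
  simp [expDiv, Nat.mul_add_div (Fact.out : p.Prime).pos]

theorem coordBilin_smul_twist (h : DirectSum.IsInternal gr) (u : Fin n → ℤ)
    (r s : PolyR n A) (m : M) :
    coordBilin h u (r • twist p n A s) m = coordBilin h u (twist p n A s) (r • m) := by
  induction r using MvPolynomial.induction_on' with
  | add r r' hr hr' =>
    rw [add_smul, add_smul, map_add, map_add, AddMonoidHom.add_apply, hr, hr']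
  | monomial c a =>
    induction s using MvPolynomial.induction_on' with
    | add s s' hs hs' =>
      rw [show twist p n A (s + s') = twist p n A s + twist p n A s' from rfl, smul_add,
        map_add, map_add, AddMonoidHom.add_apply, AddMonoidHom.add_apply, hs, hs']
    | monomial d b =>
      rw [smul_twist, MvPolynomial.monomial_pow, MvPolynomial.monomial_mul,
        coordBilin_monomial, coordBilin_monomial]
      have hiff : (∀ i, (((p • c + d) i : ℕ) : ℤ) % p = u i % p) ↔
          ∀ i, (d i : ℤ) % p = u i % p := by
        simp
      simp only [hiff]
      split_ifs
      · rw [← smul_toFrobBase, TensorProduct.smul_tmul, ← map_smul, expDiv_smul_add,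
          ← mul_smul (MvPolynomial.monomial (expDiv p d) 1 : PolyR n A),
          MvPolynomial.monomial_mul, one_mul, monomial_smul_eq _ a, add_comm]
      · rfl

theorem coordBilin_balanced (h : DirectSum.IsInternal gr) (u : Fin n → ℤ)
    (r : PolyR n A) (s : FrobTwist p n A) (m : M) :
    coordBilin h u (r • s) m = coordBilin h u s (r • m) :=
  coordBilin_smul_twist h u r s m

/-- The degree-`u` coordinate of an element of `F(M)`. -/
def coord (h : DirectSum.IsInternal gr) (u : Fin n → ℤ) :
    FF p n A M →+ FrobBase p A ⊗[A] gr (floorDiv p u) :=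
  TensorProduct.liftAddHom (coordBilin h u) (coordBilin_balanced h u)

theorem coord_tmul (h : DirectSum.IsInternal gr) (u : Fin n → ℤ) (r : PolyR n A) (m : M) :
    coord h u (FF.of p n A M (twist p n A r ⊗ₜ m)) = coordBilin h u (twist p n A r) m := rfl

omit [Module A M] [IsScalarTower A (PolyR n A) M] in
theorem FF.induction_tmul {P : FF p n A M → Prop} (x : FF p n A M) (zero : P 0)
    (add : ∀ x y, P x → P y → P (x + y))
    (tmul : ∀ r m, P (FF.of p n A M (twist p n A r ⊗ₜ m))) : P x :=
  TensorProduct.induction_on (motive := P) x zero tmul add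

omit [Module A M] [IsScalarTower A (PolyR n A) M] in
theorem smul_of_tmul (a : A) (r : PolyR n A) (m : M) :
    a • FF.of p n A M (twist p n A r ⊗ₜ m) =
      FF.of p n A M (twist p n A (MvPolynomial.C a * r) ⊗ₜ m) := rfl

theorem coord_smul (h : DirectSum.IsInternal gr) (u : Fin n → ℤ) (a : A) (x : FF p n A M) :
    coord h u (a • x) = toFrobBase p A a • coord h u x := by
  induction x using FF.induction_tmul with
  | zero => rw [smul_zero, map_zero, smul_zero]
  | add x y hx hy => rw [smul_add, map_add, map_add, smul_add, hx, hy]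
  | tmul r m =>
    rw [smul_of_tmul, coord_tmul, coord_tmul]
    induction r using MvPolynomial.induction_on' with
    | add s s' hs hs' =>
      rw [mul_add, show ∀ s s', twist p n A (s + s') = twist p n A s + twist p n A s' from
        fun _ _ => rfl, map_add, AddMonoidHom.add_apply, hs, hs', ← smul_add,
        ← AddMonoidHom.add_apply, ← map_add]
      rfl
    | monomial d b =>
      rw [MvPolynomial.C_mul_monomial, coordBilin_monomial, coordBilin_monomial]
      split_ifs
      · rw [TensorProduct.smul_tmul', smul_eq_mul, map_mul]
      · rw [smul_zero]

/-- `a ⊗ m ↦ a X^e ⊗ m`, where `e` is the residue of `u` modulo `p`. -/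
def insertAt (gr : (Fin n → ℤ) → Submodule A M) (u : Fin n → ℤ) :
    FrobBase p A ⊗[A] gr (floorDiv p u) →+ FF p n A M :=
  TensorProduct.liftAddHom
    (AddMonoidHom.mk' (fun a => AddMonoidHom.mk' (fun m => FF.of p n A M
        (twist p n A (MvPolynomial.monomial (residue p u) ((toFrobBase p A).symm a)) ⊗ₜ (m : M)))
        (fun x y => TensorProduct.tmul_add _ _ _))
      (fun a b => by
        ext m
        change FF.of p n A M (twist p n A (MvPolynomial.monomial (residue p u)
          ((toFrobBase p A).symm (a + b))) ⊗ₜ (m : M)) = _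
        rw [map_add, map_add]
        exact TensorProduct.add_tmul _ _ _))
    (fun a b m => by
      obtain ⟨b, rfl⟩ := (toFrobBase p A).surjective b
      change FF.of p n A M (twist p n A (MvPolynomial.monomial (residue p u) (a ^ p * b)) ⊗ₜ
        (m : M)) = FF.of p n A M (twist p n A (MvPolynomial.monomial (residue p u) b) ⊗ₜ
        (a • (m : M)))
      rw [← algebraMap_smul (PolyR n A) a (m : M), ← TensorProduct.smul_tmul, smul_twist,
        MvPolynomial.algebraMap_eq, ← map_pow, MvPolynomial.C_mul_monomial])

theorem insertAt_tmul (u : Fin n → ℤ) (a : A) (m : gr (floorDiv p u)) :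
    insertAt gr u (toFrobBase p A a ⊗ₜ m) =
      FF.of p n A M (twist p n A (MvPolynomial.monomial (residue p u) a) ⊗ₜ (m : M)) := rfl

theorem insertAt_smul (u : Fin n → ℤ) (a : A) (t : FrobBase p A ⊗[A] gr (floorDiv p u)) :
    insertAt gr u (toFrobBase p A a • t) = a • insertAt gr u t := by
  induction t with
  | zero => rw [smul_zero, map_zero, smul_zero]
  | add x y hx hy => rw [smul_add, map_add, map_add, smul_add, hx, hy]
  | tmul b m =>
    obtain ⟨b, rfl⟩ := (toFrobBase p A).surjective b
    rw [TensorProduct.smul_tmul', smul_eq_mul, ← map_mul, insertAt_tmul, insertAt_tmul,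
      smul_of_tmul, MvPolynomial.C_mul_monomial]

theorem residue_apply (u : Fin n → ℤ) (i : Fin n) : ((residue p u i : ℕ) : ℤ) = u i % p := by
  have : (p : ℤ) ≠ 0 := by exact_mod_cast (Fact.out : p.Prime).ne_zero
  simpa [residue] using Int.emod_nonneg _ this

theorem expDiv_residue (u : Fin n → ℤ) : expDiv p (residue p u) = 0 := by
  ext i
  have hp : (0 : ℤ) < p := by exact_mod_cast (Fact.out : p.Prime).pos
  have : residue p u i < p := by
    have := Int.emod_lt_of_pos (u i) hp
    rw [← residue_apply] at this
    exact_mod_cast this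
  simpa [expDiv] using Nat.div_eq_of_lt this

theorem coord_insertAt (h : DirectSum.IsInternal gr) (u : Fin n → ℤ)
    (t : FrobBase p A ⊗[A] gr (floorDiv p u)) :
    coord h u (insertAt gr u t) = t := by
  induction t with
  | zero => rw [map_zero, map_zero]
  | add x y hx hy => rw [map_add, map_add, hx, hy]
  | tmul b m =>
    obtain ⟨b, rfl⟩ := (toFrobBase p A).surjective b
    rw [insertAt_tmul, coord_tmul, coordBilin_monomial, if_pos, expDiv_residue,
      MvPolynomial.monomial_zero', map_one, one_smul, proj_self]
    intro i
    rw [residue_apply, Int.emod_emod_of_dvd _ dvd_rfl]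

theorem coord_insertAt_ne (h : DirectSum.IsInternal gr) {u w : Fin n → ℤ} (hw : w ≠ u)
    (t : FrobBase p A ⊗[A] gr (floorDiv p w)) :
    coord h u (insertAt gr w t) = 0 := by
  induction t with
  | zero => rw [map_zero, map_zero]
  | add x y hx hy => rw [map_add, map_add, hx, hy, add_zero]
  | tmul b m =>
    obtain ⟨b, rfl⟩ := (toFrobBase p A).surjective b
    rw [insertAt_tmul, coord_tmul, coordBilin_monomial, expDiv_residue,
      MvPolynomial.monomial_zero', map_one, one_smul]
    split_ifs with hres
    · rw [proj_of_ne, TensorProduct.tmul_zero]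
      intro hdiv
      refine hw (funext fun i => ?_)
      have h₁ := hres i
      have h₂ := congrFun hdiv i
      rw [residue_apply, Int.emod_emod_of_dvd _ dvd_rfl] at h₁
      simp only [floorDiv] at h₂
      rw [← Int.mul_ediv_add_emod (w i) p, ← Int.mul_ediv_add_emod (u i) p, h₁, h₂]
    · rfl

theorem exists_insertAt_of_mem_comp
    (hX : ∀ (i : Fin n) (u : Fin n → ℤ), ∀ m ∈ gr u,
      (MvPolynomial.X i : PolyR n A) • m ∈ gr (u + Pi.single i 1))
    (u : Fin n → ℤ) {x : FF p n A M} (hx : x ∈ FF.comp p n A M gr u) :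
    ∃ t, insertAt gr u t = x := by
  induction hx using Submodule.span_induction with
  | zero => exact ⟨0, map_zero _⟩
  | add x y _ _ hx hy =>
    obtain ⟨s, rfl⟩ := hx
    obtain ⟨t, rfl⟩ := hy
    exact ⟨s + t, map_add _ _ _⟩
  | smul a x _ hx =>
    obtain ⟨t, rfl⟩ := hx
    exact ⟨toFrobBase p A a • t, insertAt_smul u a t⟩
  | mem x hx =>
    obtain ⟨r, d, v, m, hr, hm, hu, rfl⟩ := hx
    rcases eq_or_ne r 0 with rfl | hr0
    · refine ⟨0, ?_⟩
      rw [map_zero]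
      exact (TensorProduct.zero_tmul _ m).symm
    obtain ⟨c, hc⟩ := MvPolynomial.support_nonempty.2 hr0
    have hrc : r = MvPolynomial.monomial c (MvPolynomial.coeff c r) := by
      ext c'
      rw [MvPolynomial.coeff_monomial]
      split_ifs with hcc
      · rw [hcc]
      · by_contra hne
        refine hcc (Finsupp.ext fun i => ?_)
        have := congrFun ((hr c hc).trans (hr c' (MvPolynomial.mem_support_iff.2 hne)).symm) i
        exact_mod_cast this
    have hui : ∀ i, u i = c i + p * v i := fun i => by
      rw [← hu, ← hr c hc]
      simp
    have hp : (p : ℤ) ≠ 0 := by exact_mod_cast (Fact.out : p.Prime).ne_zero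
    have hdiv : (v + fun i => ((expDiv p c i : ℕ) : ℤ)) = floorDiv p u := by
      ext i
      simp [expDiv, floorDiv, hui, Int.add_mul_ediv_left _ (v i) hp]
      ring
    have hres : p • expDiv p c + residue p u = c := by
      ext i
      zify
      rw [Pi.add_apply, Nat.cast_add, residue_apply, hui]
      simpa [expDiv] using Int.mul_ediv_add_emod (c i : ℤ) p
    have hmem := monomial_smul_mem hX (expDiv p c) hm
    rw [hdiv] at hmem
    refine ⟨toFrobBase p A (MvPolynomial.coeff c r) ⊗ₜ ⟨_, hmem⟩, ?_⟩
    rw [insertAt_tmul, ← TensorProduct.smul_tmul, smul_twist, MvPolynomial.monomial_pow,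
      MvPolynomial.monomial_mul, one_pow, one_mul, hres, ← hrc]

/-- `M_u` is the base change of `M_⌊u/p⌋` along the Frobenius of `A`. -/
theorem exists_component_equiv (h : DirectSum.IsInternal gr)
    (hX : ∀ (i : Fin n) (u : Fin n → ℤ), ∀ m ∈ gr u,
      (MvPolynomial.X i : PolyR n A) • m ∈ gr (u + Pi.single i 1))
    (theta : M ≃ₗ[PolyR n A] FF p n A M)
    (theta_grade : ∀ (u : Fin n → ℤ), ∀ m ∈ gr u, theta m ∈ FF.comp p n A M gr u)
    (u : Fin n → ℤ) :
    ∃ e : gr u ≃+ FrobBase p A ⊗[A] gr (floorDiv p u),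
      ∀ (a : A) (m : gr u), e (a • m) = toFrobBase p A a • e m := by
  have key : ∀ m : M, coord h u (theta m) = coord h u (theta (proj h u m)) := by
    intro m
    have hm : m ∈ ⨆ w, gr w := by
      rw [h.submodule_iSup_eq_top]
      trivial
    induction hm using Submodule.iSup_induction' with
    | zero => simp
    | add x y _ _ hx hy =>
      rw [map_add, map_add, map_add, hx, hy, Submodule.coe_add, map_add, map_add]
    | mem w x hx =>
      rcases eq_or_ne w u with rfl | hw
      · rw [proj_self h w ⟨x, hx⟩]
      · obtain ⟨t, ht⟩ := exists_insertAt_of_mem_comp hX w (theta_grade w x hx)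
        rw [proj_of_ne h hw ⟨x, hx⟩, ← ht, coord_insertAt_ne h hw]
        simp
  let f : gr u →+ FrobBase p A ⊗[A] gr (floorDiv p u) :=
    (coord h u).comp (theta.toLinearMap.toAddMonoidHom.comp (gr u).subtype.toAddMonoidHom)
  have hf : ∀ m : gr u, f m = coord h u (theta m) := fun _ => rfl
  have hinj : Function.Injective f := by
    rw [injective_iff_map_eq_zero]
    intro m hm
    obtain ⟨t, ht⟩ := exists_insertAt_of_mem_comp hX u (theta_grade u m m.2)
    rw [hf, ← ht, coord_insertAt] at hm
    rw [hm, map_zero] at ht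
    exact Subtype.ext (theta.map_eq_zero_iff.1 ht.symm)
  have hsurj : Function.Surjective f := by
    intro t
    refine ⟨proj h u (theta.symm (insertAt gr u t)), ?_⟩
    rw [hf, ← key, LinearEquiv.apply_symm_apply, coord_insertAt]
  refine ⟨AddEquiv.ofBijective f ⟨hinj, hsurj⟩, fun a m => ?_⟩
  change f (a • m) = _ • f m
  rw [hf, hf, Submodule.coe_smul, ← algebraMap_smul (PolyR n A) a (m : M), map_smul,
    algebraMap_smul, coord_smul]

theorem nonempty_equiv_of_floorDiv (h : DirectSum.IsInternal gr)
    (hX : ∀ (i : Fin n) (u : Fin n → ℤ), ∀ m ∈ gr u,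
      (MvPolynomial.X i : PolyR n A) • m ∈ gr (u + Pi.single i 1))
    (theta : M ≃ₗ[PolyR n A] FF p n A M)
    (theta_grade : ∀ (u : Fin n → ℤ), ∀ m ∈ gr u, theta m ∈ FF.comp p n A M gr u)
    {u v : Fin n → ℤ}
    (e : gr (floorDiv p u) ≃ₗ[A] gr (floorDiv p v)) :
    Nonempty (gr u ≃ₗ[A] gr v) := by
  obtain ⟨e₁, h₁⟩ := exists_component_equiv h hX theta theta_grade u
  obtain ⟨e₂, h₂⟩ := exists_component_equiv h hX theta theta_grade v
  let e' := e.baseChange A (FrobBase p A) _ _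
  refine ⟨((e₁.trans e'.toAddEquiv).trans e₂.symm).toLinearEquiv fun a m => ?_⟩
  apply e₂.injective
  simp [h₁, h₂]

theorem nonempty_equiv_of_mem_block (h : DirectSum.IsInternal gr)
    (hX : ∀ (i : Fin n) (u : Fin n → ℤ), ∀ m ∈ gr u,
      (MvPolynomial.X i : PolyR n A) • m ∈ gr (u + Pi.single i 1))
    (theta : M ≃ₗ[PolyR n A] FF p n A M)
    (theta_grade : ∀ (u : Fin n → ℤ), ∀ m ∈ gr u, theta m ∈ FF.comp p n A M gr u)
    {U : Set (Fin n)} {u v : Fin n → ℤ} (hu : u ∈ Block n U) (hv : v ∈ Block n U) :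
    Nonempty (gr u ≃ₗ[A] gr v) := by
  have hp : (2 : ℤ) ≤ p := by exact_mod_cast (Fact.out : p.Prime).two_le
  have hp0 : (0 : ℤ) < p := by omega
  have hblock : ∀ {w : Fin n → ℤ}, w ∈ Block n U → floorDiv p w ∈ Block n U := fun hw i =>
    ⟨fun hi => Int.ediv_nonneg ((hw i).1 hi) hp0.le, fun hi => Int.lt_add_one_iff.1
      ((Int.ediv_lt_iff_lt_mul hp0).2 (by have := (hw i).2 hi; linarith))⟩
  have hbound : ∀ (N : ℕ) (w : Fin n → ℤ), (∀ i, -1 - ((N + 1 : ℕ) : ℤ) ≤ w i ∧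
      w i ≤ (N + 1 : ℕ)) → ∀ i, -1 - (N : ℤ) ≤ floorDiv p w i ∧ floorDiv p w i ≤ N := by
    intro N w hw i
    obtain ⟨h₁, h₂⟩ := hw i
    push_cast at h₁ h₂
    refine ⟨(Int.le_ediv_iff_mul_le hp0).2 (by nlinarith), Int.lt_add_one_iff.1
      ((Int.ediv_lt_iff_lt_mul hp0).2 (by nlinarith))⟩
  have main : ∀ (N : ℕ) {u v : Fin n → ℤ}, u ∈ Block n U → v ∈ Block n U →
      (∀ i, -1 - (N : ℤ) ≤ u i ∧ u i ≤ N) → (∀ i, -1 - (N : ℤ) ≤ v i ∧ v i ≤ N) →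
      Nonempty (gr u ≃ₗ[A] gr v) := by
    intro N
    induction N with
    | zero =>
      intro u v hu hv hu' hv'
      obtain rfl : u = v := funext fun i => by
        have h₁ := hu' i
        have h₂ := hv' i
        by_cases hi : i ∈ U
        · have h₃ := (hu i).1 hi
          have h₄ := (hv i).1 hi
          omega
        · have h₃ := (hu i).2 hi
          have h₄ := (hv i).2 hi
          omega
      exact ⟨LinearEquiv.refl _ _⟩
    | succ N ih =>
      intro u v hu hv hu' hv'
      obtain ⟨e⟩ := ih (hblock hu) (hblock hv) (hbound N u hu') (hbound N v hv')
      exact nonempty_equiv_of_floorDiv h hX theta theta_grade e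
  have hle : ∀ i, (u i).natAbs + (v i).natAbs ≤ ∑ i, ((u i).natAbs + (v i).natAbs) := fun i =>
    Finset.single_le_sum (f := fun i => (u i).natAbs + (v i).natAbs)
      (fun _ _ => Nat.zero_le _) (Finset.mem_univ i)
  exact main (∑ i, ((u i).natAbs + (v i).natAbs)) hu hv
    (fun i => by have := hle i; omega) (fun i => by have := hle i; omega)

end FrobeniusComponents

/-- **Theorem E.** With `A = K[[Y]]`, `char K = p > 0`, `M` a `ℤⁿ`-graded
`F`-finite `F`-module over `R = A[X₁,…,Xₙ]`, `U ⊆ {1,…,n}` and `u, v ∈ B(U)`: if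
`M_u ≅ (Q(A)/A)^a ⊕ Q(A)^b ⊕ A^c` and `M_v ≅ (Q(A)/A)^{a'} ⊕ Q(A)^{b'} ⊕ A^{c'}` as
`A`-modules, then `a = a'`, `b = b'` and `c = c'`; i.e. the numbers occurring in the structure
theorem are constant on each block `B(U)`. -/
theorem structure_numbers_constant_on_blocks
    (p n : ℕ) [Fact p.Prime] (K : Type) [Field K] [CharP K p]
    (M : Type) [AddCommGroup M] [Module (PowerSeries K) M]
    [Module (PolyR n (PowerSeries K)) M]
    [IsScalarTower (PowerSeries K) (PolyR n (PowerSeries K)) M]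
    (gr : (Fin n → ℤ) → Submodule (PowerSeries K) M)
    (hM : ZGradedFFiniteFModule p n (PowerSeries K) M gr)
    (U : Set (Fin n)) (u v : Fin n → ℤ) (hu : u ∈ Block n U) (hv : v ∈ Block n U)
    (a b c a' b' c' : ℕ)
    (eu : Nonempty (↥(gr u) ≃ₗ[PowerSeries K]
      ((Fin a → QmodA K) × (Fin b → QA K) × (Fin c → PowerSeries K))))
    (ev : Nonempty (↥(gr v) ≃ₗ[PowerSeries K]
      ((Fin a' → QmodA K) × (Fin b' → QA K) × (Fin c' → PowerSeries K)))) :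
    a = a' ∧ b = b' ∧ c = c' := by
  obtain ⟨eu⟩ := eu
  obtain ⟨ev⟩ := ev
  obtain ⟨e⟩ := nonempty_equiv_of_mem_block hM.isInternal hM.smul_X_mem hM.theta hM.theta_grade
    hu hv
  exact stdModule_unique K ((eu.symm.trans e).trans ev)
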